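/- The annihilation algebra g(RE(5,10)) is isomorphic, as a ℤ-graded Lie superalgebra, to E(5,10) with its principal gradation, under the map Φ: a_{ij} y^M ↦ −m_i x^{M−e_i} ∂_{x_j} + m_j x^{M−e_j} ∂_{x_i} and b_k y^M ↦ Σ_{r≠k} m_r x^{M−e_r} d_{kr}, where M = (m_1,…,m_5) ∈ ℤ_{≥0}^5 and e_i is the i-th coordinate vector. -/

import Mathlib

/-!
# Statement 18 (Theorem 6.12: `g(RE(5,10)) ≅ E(5,10)`)

The annihilation algebra `g(RE(5,10))` is spanned by the symbols `a_{ij} y^M`, `b_k y^M`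
subject to the relations (i) `a_{ij} y^M + a_{ji} y^M = 0`,
(ii) `a_{ij}(∂_{y_h} y^M) + a_{jh}(∂_{y_i} y^M) + a_{hi}(∂_{y_j} y^M) = 0`,
(iii) `Σ_k b_k (∂_{y_k} y^M) = 0`, and carries the Lie superalgebra bracket induced by
the `λ`-brackets of `RE(5,10)`.

`E(5,10)` has even part `S₅` (divergence-zero formal vector fields in `x₁,…,x₅`,
a basis of the ambient space of vector fields being the `x^N ∂_{x_i}`) and odd part the
closed 2-forms `Ω²_cl` (the ambient 2-forms having basis `x^N dx_i∧dx_j`, `i<j`, encoded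
here by pairs `(S, N)` with `S` a 2-element subset of `Fin 5`), with its standard bracket
and principal ℤ-gradation.  (We use polynomial coefficients; the principal gradation only
involves the polynomial homogeneous components.)

The theorem: the map `Φ : a_{ij} y^M ↦ -m_i x^{M-e_i} ∂_{x_j} + m_j x^{M-e_j} ∂_{x_i}`,
`b_k y^M ↦ Σ_{r≠k} m_r x^{M-e_r} dx_k∧dx_r` induces an isomorphism of ℤ-graded Lie
superalgebras `g(RE(5,10)) ≅ E(5,10)`.
-/

open Finsupp

variable (𝔽 : Type) [Field 𝔽] [CharZero 𝔽] [IsAlgClosed 𝔽]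

abbrev Exp5 := Fin 5 →₀ ℕ

/-! ## The ambient space of `E(5,10)` -/

/-- Basis keys for the ambient space of `E(5,10)`: `inl (i, N)` is the vector field
`x^N ∂_{x_i}`; `inr (S, N)` with `S = {i < j}` is the 2-form `x^N dx_i ∧ dx_j`. -/
abbrev EKey := Sum (Fin 5 × Exp5) (Finset (Fin 5) × Exp5)

abbrev EAmb (𝔽 : Type) [Field 𝔽] := EKey →₀ 𝔽

/-- The sign of the permutation sorting a list of indices (`0` if it has repetitions). -/
def levList : List (Fin 5) → ℤ
  | [] => 1
  | a :: rest => (rest.map fun b => Int.sign ((b : ℤ) - (a : ℤ))).prod * levList rest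

/-- The 2-form `x^N dx_a ∧ dx_b` for an arbitrary ordered pair, given as the length-2
list `[a, b]`, expressed in the canonical basis (with its sign). -/
noncomputable def form2 (l : List (Fin 5)) (N : Exp5) : EAmb 𝔽 :=
  (levList l : 𝔽) • Finsupp.single (Sum.inr (l.toFinset, N)) 1

/-- Bilinear extension of a function defined on basis keys. -/
noncomputable def biext {α β : Type} {C : Type} [AddCommGroup C] [Module 𝔽 C]
    (v : α → β → C) : (α →₀ 𝔽) →ₗ[𝔽] (β →₀ 𝔽) →ₗ[𝔽] C :=
  Finsupp.lsum 𝔽 fun a =>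
    LinearMap.toSpanSingleton 𝔽 ((β →₀ 𝔽) →ₗ[𝔽] C)
      (Finsupp.lsum 𝔽 fun b => LinearMap.toSpanSingleton 𝔽 C (v a b))

/-- The bracket of `E(5,10)` on basis elements:
 * two vector fields: the usual bracket of vector fields;
 * a vector field and a 2-form: the Lie derivative;
 * two 2-forms: `[f dx_i∧dx_j, g dx_k∧dx_l] = ε_{ijkl} f g ∂_{x_{t_{ijkl}}}`. -/
noncomputable def Ebval : EKey → EKey → EAmb 𝔽
  | Sum.inl (i, M), Sum.inl (j, N) =>
      (N i : 𝔽) • Finsupp.single (Sum.inl (j, M + N - Finsupp.single i 1)) 1 -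
        (M j : 𝔽) • Finsupp.single (Sum.inl (i, M + N - Finsupp.single j 1)) 1
  | Sum.inl (i, M), Sum.inr (T, N) =>
      (N i : 𝔽) • Finsupp.single (Sum.inr (T, M + N - Finsupp.single i 1)) 1 +
        (if i ∈ T then
          ∑ h : Fin 5, (M h : 𝔽) •
            form2 𝔽 ((T.sort (· ≤ ·)).map fun a => if a = i then h else a)
              (M + N - Finsupp.single h 1)
        else 0)
  | Sum.inr (T, N), Sum.inl (i, M) =>
      -((N i : 𝔽) • Finsupp.single (Sum.inr (T, M + N - Finsupp.single i 1)) 1 +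
        (if i ∈ T then
          ∑ h : Fin 5, (M h : 𝔽) •
            form2 𝔽 ((T.sort (· ≤ ·)).map fun a => if a = i then h else a)
              (M + N - Finsupp.single h 1)
        else 0))
  | Sum.inr (S, M), Sum.inr (T, N) =>
      ∑ t : Fin 5,
        (levList (S.sort (· ≤ ·) ++ T.sort (· ≤ ·) ++ [t]) : 𝔽) •
          Finsupp.single (Sum.inl (t, M + N)) 1

/-- The bracket of `E(5,10)` (on the ambient space). -/
noncomputable def Ebr : EAmb 𝔽 →ₗ[𝔽] EAmb 𝔽 →ₗ[𝔽] EAmb 𝔽 := biext 𝔽 (Ebval 𝔽)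

/-- The divergence, on the ambient space. -/
noncomputable def divMap : EAmb 𝔽 →ₗ[𝔽] (Exp5 →₀ 𝔽) :=
  Finsupp.lsum 𝔽 fun k =>
    match k with
    | Sum.inl (i, M) => (M i : 𝔽) • Finsupp.lsingle (M - Finsupp.single i 1)
    | Sum.inr _ => 0

/-- The de Rham differential on 2-forms (3-forms being encoded by pairs `(S, N)` with
`S` a 3-element subset), extended by `0` on vector fields. -/
noncomputable def dMap : EAmb 𝔽 →ₗ[𝔽] ((Finset (Fin 5) × Exp5) →₀ 𝔽) :=
  Finsupp.lsum 𝔽 fun k =>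
    match k with
    | Sum.inl _ => 0
    | Sum.inr (S, N) =>
        LinearMap.toSpanSingleton 𝔽 _
          (∑ h : Fin 5, ((N h : 𝔽) * (levList (h :: S.sort (· ≤ ·)) : 𝔽)) •
            Finsupp.single (insert h S, N - Finsupp.single h 1) (1 : 𝔽))

/-- The valid basis keys (2-forms must be indexed by 2-element subsets). -/
def validKeys : Set EKey := {k | match k with | Sum.inl _ => True | Sum.inr (S, _) => S.card = 2}

/-- `E(5,10) ⊆` ambient space: divergence-zero vector fields plus closed 2-forms. -/
noncomputable def E510 : Submodule 𝔽 (EAmb 𝔽) :=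
  (LinearMap.ker (divMap 𝔽) ⊓ LinearMap.ker (dMap 𝔽)) ⊓
    Finsupp.supported 𝔽 𝔽 validKeys

/-! ## The annihilation algebra `g(RE(5,10))` -/

/-- Spanning symbols: `inl (i,j)` is `a_{ij} y^M`, `inr k` is `b_k y^M`. -/
abbrev AnnSym := Sum (Fin 5 × Fin 5) (Fin 5) × Exp5

abbrev AnnFree (𝔽 : Type) [Field 𝔽] := AnnSym →₀ 𝔽

noncomputable def relSkew (i j : Fin 5) (M : Exp5) : AnnFree 𝔽 :=
  Finsupp.single (Sum.inl (i, j), M) 1 + Finsupp.single (Sum.inl (j, i), M) 1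

noncomputable def relCyc (h i j : Fin 5) (M : Exp5) : AnnFree 𝔽 :=
  (M h : 𝔽) • Finsupp.single (Sum.inl (i, j), M - Finsupp.single h 1) 1 +
    (M i : 𝔽) • Finsupp.single (Sum.inl (j, h), M - Finsupp.single i 1) 1 +
    (M j : 𝔽) • Finsupp.single (Sum.inl (h, i), M - Finsupp.single j 1) 1

noncomputable def relDiv (M : Exp5) : AnnFree 𝔽 :=
  ∑ k : Fin 5, (M k : 𝔽) • Finsupp.single (Sum.inr k, M - Finsupp.single k 1) 1

noncomputable def annRels : Submodule 𝔽 (AnnFree 𝔽) :=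
  Submodule.span 𝔽
    ((Set.range fun x : (Fin 5 × Fin 5) × Exp5 => relSkew 𝔽 x.1.1 x.1.2 x.2) ∪
      (Set.range fun x : (Fin 5 × Fin 5 × Fin 5) × Exp5 =>
        relCyc 𝔽 x.1.1 x.1.2.1 x.1.2.2 x.2) ∪
      (Set.range fun M : Exp5 => relDiv 𝔽 M))

/-- The annihilation algebra `g(RE(5,10))` as a vector space. -/
abbrev AnnRE (𝔽 : Type) [Field 𝔽] [CharZero 𝔽] [IsAlgClosed 𝔽] := AnnFree 𝔽 ⧸ annRels 𝔽

/-- The class of `a_{ij} y^M`. -/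
noncomputable def aSym (i j : Fin 5) (M : Exp5) : AnnRE 𝔽 :=
  Submodule.Quotient.mk (Finsupp.single (Sum.inl (i, j), M) 1)

/-- The class of `b_k y^M`. -/
noncomputable def bSym (k : Fin 5) (M : Exp5) : AnnRE 𝔽 :=
  Submodule.Quotient.mk (Finsupp.single (Sum.inr k, M) 1)

/-- The bracket `[a_{ij} y^M, a_{rs} y^N]` of `g(RE(5,10))`, computed from the
`λ`-bracket of `RE(5,10)`. -/
noncomputable def gaa (i j : Fin 5) (M : Exp5) (rr ss : Fin 5) (N : Exp5) : AnnRE 𝔽 :=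
  (((M j : ℤ) * ((M rr : ℤ) - if j = rr then 1 else 0) : ℤ) : 𝔽) •
      aSym 𝔽 ss i (M - Finsupp.single j 1 - Finsupp.single rr 1 + N) +
    (((M i : ℤ) * ((M rr : ℤ) - if i = rr then 1 else 0) : ℤ) : 𝔽) •
      aSym 𝔽 j ss (M - Finsupp.single i 1 - Finsupp.single rr 1 + N) +
    (((M i : ℤ) * ((M ss : ℤ) - if i = ss then 1 else 0) : ℤ) : 𝔽) •
      aSym 𝔽 rr j (M - Finsupp.single i 1 - Finsupp.single ss 1 + N) +
    (((M j : ℤ) * ((M ss : ℤ) - if j = ss then 1 else 0) : ℤ) : 𝔽) •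
      aSym 𝔽 i rr (M - Finsupp.single j 1 - Finsupp.single ss 1 + N) -
    (((M i : ℤ) * (((M + N) j : ℤ) - if i = j then 1 else 0) : ℤ) : 𝔽) •
      aSym 𝔽 rr ss (M + N - Finsupp.single i 1 - Finsupp.single j 1) -
    (((M j : ℤ) * (((M + N) i : ℤ) - if i = j then 1 else 0) : ℤ) : 𝔽) •
      aSym 𝔽 ss rr (M + N - Finsupp.single i 1 - Finsupp.single j 1)

/-- The bracket `[a_{ij} y^M, b_k y^N]` of `g(RE(5,10))`. -/
noncomputable def gab (i j : Fin 5) (M : Exp5) (k : Fin 5) (N : Exp5) : AnnRE 𝔽 :=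
  ((-((M i : ℤ) * (((M + N) j : ℤ) - if i = j then 1 else 0)) +
      (M j : ℤ) * (((M + N) i : ℤ) - if i = j then 1 else 0) : ℤ) : 𝔽) •
      bSym 𝔽 k (M + N - Finsupp.single i 1 - Finsupp.single j 1) +
    (if i = k then
      ∑ t : Fin 5, (((M j : ℤ) * ((M t : ℤ) - if j = t then 1 else 0) : ℤ) : 𝔽) •
        bSym 𝔽 t (M + N - Finsupp.single j 1 - Finsupp.single t 1)
    else 0) -
    (if j = k then
      ∑ t : Fin 5, (((M i : ℤ) * ((M t : ℤ) - if i = t then 1 else 0) : ℤ) : 𝔽) •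
        bSym 𝔽 t (M + N - Finsupp.single i 1 - Finsupp.single t 1)
    else 0)

/-- The bracket `[b_i y^M, b_j y^N]` of `g(RE(5,10))`. -/
noncomputable def gbb (i : Fin 5) (M : Exp5) (j : Fin 5) (N : Exp5) : AnnRE 𝔽 :=
  (2 : 𝔽)⁻¹ • ∑ h : Fin 5, ∑ k : Fin 5, ∑ l : Fin 5,
    ((levList [i, j, h, k, l] : ℤ) : 𝔽) • ((M h : 𝔽) •
      aSym 𝔽 k l (M - Finsupp.single h 1 + N))

set_option linter.unusedSectionVars false

open MvPolynomial

/-- The linear map out of the polynomial ring sending each monic monomial `x^N` to `v N`. -/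
noncomputable def polyLift {C : Type} [AddCommGroup C] [Module 𝔽 C] (v : Exp5 → C) :
    MvPolynomial (Fin 5) 𝔽 →ₗ[𝔽] C :=
  (basisMonomials (Fin 5) 𝔽).constr 𝔽 v

lemma polyLift_monomial {C : Type} [AddCommGroup C] [Module 𝔽 C] (v : Exp5 → C) (N : Exp5)
    (c : 𝔽) : polyLift 𝔽 v (monomial N c) = c • v N := by
  have h : polyLift 𝔽 v (monomial N 1) = v N := by
    rw [polyLift]
    exact (basisMonomials (Fin 5) 𝔽).constr_basis 𝔽 v N
  rw [← h, ← map_smul, smul_monomial, smul_eq_mul, mul_one]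

lemma pderiv_comm' (i j : Fin 5) (f : MvPolynomial (Fin 5) 𝔽) :
    pderiv i (pderiv j f) = pderiv j (pderiv i f) := by
  have h : ⁅(pderiv i : Derivation 𝔽 (MvPolynomial (Fin 5) 𝔽) (MvPolynomial (Fin 5) 𝔽)),
      (pderiv j : Derivation 𝔽 (MvPolynomial (Fin 5) 𝔽) (MvPolynomial (Fin 5) 𝔽))⁆ = 0 := by
    apply MvPolynomial.derivation_ext
    intro k
    simp only [Derivation.commutator_apply, pderiv_X, Pi.single_apply, Derivation.coe_zero,
      Pi.zero_apply]
    split_ifs <;> simp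
  have := congrArg (fun D => D f) h
  simpa [Derivation.commutator_apply, sub_eq_zero] using this

/-- The vector field `f ∂_{x_i}`. -/
noncomputable def vecField (i : Fin 5) : MvPolynomial (Fin 5) 𝔽 →ₗ[𝔽] EAmb 𝔽 :=
  polyLift 𝔽 fun N => Finsupp.single (Sum.inl (i, N)) 1

/-- The basis 2-form attached to a finset `S` with coefficient `f`. -/
noncomputable def keyForm (S : Finset (Fin 5)) : MvPolynomial (Fin 5) 𝔽 →ₗ[𝔽] EAmb 𝔽 :=
  polyLift 𝔽 fun N => Finsupp.single (Sum.inr (S, N)) 1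

/-- The 2-form `f dx_a ∧ dx_b`. -/
noncomputable def wedge (a b : Fin 5) : MvPolynomial (Fin 5) 𝔽 →ₗ[𝔽] EAmb 𝔽 :=
  (levList [a, b] : 𝔽) • keyForm 𝔽 {a, b}

/-- The element `a_{ij} f`. -/
noncomputable def aPoly (i j : Fin 5) : MvPolynomial (Fin 5) 𝔽 →ₗ[𝔽] AnnRE 𝔽 :=
  polyLift 𝔽 (aSym 𝔽 i j)

/-- The element `b_k f`. -/
noncomputable def bPoly (k : Fin 5) : MvPolynomial (Fin 5) 𝔽 →ₗ[𝔽] AnnRE 𝔽 :=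
  polyLift 𝔽 (bSym 𝔽 k)

/-- The function `f` as a divergence. -/
noncomputable def polyFun : MvPolynomial (Fin 5) 𝔽 →ₗ[𝔽] (Exp5 →₀ 𝔽) :=
  polyLift 𝔽 fun N => Finsupp.single N 1

/-- The basis 3-form attached to a finset `S` with coefficient `f`. -/
noncomputable def keyForm3 (S : Finset (Fin 5)) :
    MvPolynomial (Fin 5) 𝔽 →ₗ[𝔽] ((Finset (Fin 5) × Exp5) →₀ 𝔽) :=
  polyLift 𝔽 fun N => Finsupp.single (S, N) 1

/-- The inverse of `E + c`, where `E` is the Euler operator. -/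
noncomputable def eulerInv (c : ℕ) : MvPolynomial (Fin 5) 𝔽 →ₗ[𝔽] MvPolynomial (Fin 5) 𝔽 :=
  polyLift 𝔽 fun N => monomial N ((N.degree + c : ℕ) : 𝔽)⁻¹

/-- Linear maps out of the polynomial ring agreeing on monic monomials are equal. -/
lemma poly_hom_ext {C : Type} [AddCommGroup C] [Module 𝔽 C]
    {u v : MvPolynomial (Fin 5) 𝔽 →ₗ[𝔽] C}
    (h : ∀ N, u (monomial N 1) = v (monomial N 1)) : u = v :=
  (basisMonomials (Fin 5) 𝔽).ext fun N => by simpa using h N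

lemma biext_single {α β : Type} {C : Type} [AddCommGroup C] [Module 𝔽 C]
    (v : α → β → C) (a : α) (b : β) :
    biext 𝔽 v (Finsupp.single a 1) (Finsupp.single b 1) = v a b := by
  simp [biext]

lemma smul_congr_of_ne_zero {C : Type} [AddCommGroup C] [Module 𝔽 C] {c : 𝔽} {x y : C}
    (h : c ≠ 0 → x = y) : c • x = c • y := by
  by_cases hc : c = 0
  · simp [hc]
  · rw [h hc]

lemma add_tsub_single {M N : Exp5} {i : Fin 5} (h : (N i : 𝔽) ≠ 0) :
    M + N - Finsupp.single i 1 = M + (N - Finsupp.single i 1) := by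
  have h1 : Finsupp.single i 1 ≤ N := by
    rw [Finsupp.single_le_iff]
    exact Nat.one_le_iff_ne_zero.2 fun h0 => h (by simp [h0])
  rw [add_tsub_assoc_of_le h1]

lemma Ebr_vec_vec (i j : Fin 5) (f g : MvPolynomial (Fin 5) 𝔽) :
    Ebr 𝔽 (vecField 𝔽 i f) (vecField 𝔽 j g) =
      vecField 𝔽 j (f * pderiv i g) - vecField 𝔽 i (g * pderiv j f) := by
  induction f using MvPolynomial.induction_on' with
  | add p q hp hq => simp only [map_add, LinearMap.add_apply, hp, hq, add_mul, mul_add]; abel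
  | monomial M c =>
    induction g using MvPolynomial.induction_on' with
    | add p q hp hq => simp only [map_add, hp, hq, add_mul, mul_add]; abel
    | monomial N d =>
      simp only [pderiv_monomial, monomial_mul, vecField, polyLift_monomial, map_smul,
        LinearMap.smul_apply, Ebr, biext_single, Ebval, smul_sub, mul_smul]
      rw [smul_comm d c]
      congr 1
      · congr 2
        exact smul_congr_of_ne_zero 𝔽 fun h => by rw [add_tsub_single 𝔽 h]
      · congr 2
        exact smul_congr_of_ne_zero 𝔽 fun h => by
          rw [add_comm M N, add_tsub_single 𝔽 h]

lemma levList_pair_swap (a b : Fin 5) : levList [a, b] = -levList [b, a] := by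
  revert a b; decide

lemma levList_pair_of_lt {a b : Fin 5} (h : a < b) : levList [a, b] = 1 := by
  revert a b; decide

lemma levList_pair_self (a : Fin 5) : levList [a, a] = 0 := by
  simp [levList]

lemma wedge_swap (a b : Fin 5) : wedge 𝔽 a b = -wedge 𝔽 b a := by
  refine LinearMap.ext fun f => ?_
  rw [LinearMap.neg_apply, wedge, wedge, LinearMap.smul_apply, LinearMap.smul_apply,
    levList_pair_swap a b, Finset.pair_comm a b, Int.cast_neg, neg_smul]

lemma wedge_self (a : Fin 5) : wedge 𝔽 a a = 0 := by
  simp [wedge, levList_pair_self]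

lemma wedge_of_lt {a b : Fin 5} (h : a < b) : wedge 𝔽 a b = keyForm 𝔽 {a, b} := by
  simp [wedge, levList_pair_of_lt h]

lemma form2_pair (a b : Fin 5) (N : Exp5) : form2 𝔽 [a, b] N = wedge 𝔽 a b (monomial N 1) := by
  simp [form2, wedge, keyForm, polyLift_monomial]

lemma sort_pair {a b : Fin 5} (h : a < b) :
    ({a, b} : Finset (Fin 5)).sort (· ≤ ·) = [a, b] := by
  rw [Finset.sort_insert, Finset.sort_singleton]
  · simpa using h.le
  · simpa using h.ne

/-- The Lie derivative of `g dx_a ∧ dx_b` along `f ∂_{x_i}`. -/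
lemma Ebr_vec_wedge (i a b : Fin 5) (f g : MvPolynomial (Fin 5) 𝔽) :
    Ebr 𝔽 (vecField 𝔽 i f) (wedge 𝔽 a b g) =
      wedge 𝔽 a b (f * pderiv i g) +
        ((if i = a then ∑ h, wedge 𝔽 h b (g * pderiv h f) else 0) +
          if i = b then ∑ h, wedge 𝔽 a h (g * pderiv h f) else 0) := by
  have key : ∀ a b : Fin 5, a < b → Ebr 𝔽 (vecField 𝔽 i f) (wedge 𝔽 a b g) =
      wedge 𝔽 a b (f * pderiv i g) +
        ((if i = a then ∑ h, wedge 𝔽 h b (g * pderiv h f) else 0) +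
          if i = b then ∑ h, wedge 𝔽 a h (g * pderiv h f) else 0) := by
    intro a b hab
    have coeff_swap (M N : Exp5) (c d : 𝔽) (h : Fin 5) :
        (monomial (N + (M - single h 1)) (d * (c * (M h : 𝔽))) : MvPolynomial (Fin 5) 𝔽) =
          d • c • (M h : 𝔽) • monomial (M + N - single h 1) 1 := by
      by_cases h0 : (M h : 𝔽) = 0
      · simp [h0]
      · rw [add_comm M N, add_tsub_single 𝔽 h0]
        simp [smul_monomial]
    have aux : ∀ f g : MvPolynomial (Fin 5) 𝔽, Ebr 𝔽 (vecField 𝔽 i f) (keyForm 𝔽 {a, b} g) =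
      keyForm 𝔽 {a, b} (f * pderiv i g) +
        if i ∈ ({a, b} : Finset (Fin 5)) then
          ∑ h, wedge 𝔽 (if a = i then h else a) (if b = i then h else b) (g * pderiv h f)
        else 0 := by
      intro f g
      induction f using MvPolynomial.induction_on' with
      | add p q hp hq =>
        simp only [map_add, LinearMap.add_apply, hp, hq, add_mul, mul_add, Finset.sum_add_distrib]
        split_ifs <;> abel
      | monomial M c =>
        induction g using MvPolynomial.induction_on' with
        | add p q hp hq =>
          simp only [map_add, hp, hq, add_mul, mul_add, Finset.sum_add_distrib]
          split_ifs <;> abel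
        | monomial N d =>
          simp only [pderiv_monomial, monomial_mul, vecField, keyForm, polyLift_monomial,
            map_smul, LinearMap.smul_apply, Ebr, biext_single, Ebval, smul_add, mul_smul,
            sort_pair hab, List.map_cons, List.map_nil, form2_pair]
          rw [smul_comm d c]
          congr 1
          · congr 2
            exact smul_congr_of_ne_zero 𝔽 fun h => by rw [add_tsub_single 𝔽 h]
          · by_cases hi : i ∈ ({a, b} : Finset (Fin 5))
            · rw [if_pos hi, if_pos hi, Finset.smul_sum, Finset.smul_sum]
              refine Finset.sum_congr rfl fun h _ => ?_
              rw [coeff_swap, map_smul, map_smul, map_smul]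
            · rw [if_neg hi, if_neg hi, smul_zero, smul_zero]
    rw [wedge_of_lt 𝔽 hab, aux]
    congr 1
    by_cases h1 : i = a
    · subst h1
      simp [hab.ne, hab.ne']
    · by_cases h2 : i = b
      · subst h2
        simp [hab.ne, hab.ne']
      · simp [h1, h2]
  rcases lt_trichotomy a b with h | h | h
  · exact key a b h
  · subst h
    by_cases hi : i = a
    · simp only [hi, wedge_self, if_true, LinearMap.zero_apply, map_zero, zero_add,
        ← Finset.sum_add_distrib]
      refine (Finset.sum_eq_zero fun t _ => ?_).symm
      rw [wedge_swap 𝔽 t a]; simp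
    · simp [hi, wedge_self]
  · rw [wedge_swap 𝔽 a b, LinearMap.neg_apply, map_neg, key b a h]
    simp only [wedge_swap 𝔽 a, wedge_swap 𝔽 _ b, LinearMap.neg_apply, Finset.sum_neg_distrib]
    split_ifs <;> simp [add_comm]

lemma levList_cons (a : Fin 5) (l : List (Fin 5)) :
    levList (a :: l) =
      (l.map fun b : Fin 5 => Int.sign ((b : ℤ) - (a : ℤ))).prod * levList l := by
  simp [levList, ← List.map_eq_flatMap, Function.comp_def]

lemma levList_append_swap (l l' : List (Fin 5)) (a b : Fin 5) :
    levList (l ++ a :: b :: l') = -levList (l ++ b :: a :: l') := by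
  induction l with
  | nil =>
    have h : Int.sign ((b : ℤ) - a) = -Int.sign ((a : ℤ) - b) := by
      rw [← Int.sign_neg, neg_sub]
    simp only [List.nil_append, levList_cons, List.map_cons, List.prod_cons, h]
    ring
  | cons c l ih =>
    simp only [List.cons_append, levList_cons, ih, List.map_append, List.map_cons, List.prod_append,
      List.prod_cons]
    ring

lemma levList_mul_levList (a b c d t : Fin 5) :
    levList [a, b] * levList [c, d] *
        levList (({a, b} : Finset (Fin 5)).sort (· ≤ ·) ++
          ({c, d} : Finset (Fin 5)).sort (· ≤ ·) ++ [t]) =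
      levList [a, b, c, d, t] := by
  have hab := levList_append_swap [] [c, d, t] a b
  have hba := levList_append_swap [] [d, c, t] b a
  have hcd := levList_append_swap [a, b] [t] c d
  have hcd' := levList_append_swap [b, a] [t] c d
  simp only [List.nil_append, List.cons_append] at hab hba hcd hcd'
  rcases lt_trichotomy a b with h | rfl | h
  · rcases lt_trichotomy c d with h' | rfl | h'
    · simp [sort_pair h, sort_pair h', levList_pair_of_lt, h, h']
    · rw [levList_pair_self]; lia
    · rw [Finset.pair_comm c d, sort_pair h, sort_pair h', levList_pair_swap c d,
        levList_pair_of_lt h, levList_pair_of_lt h']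
      simp [hcd]
  · rw [levList_pair_self]; lia
  · rcases lt_trichotomy c d with h' | rfl | h'
    · rw [Finset.pair_comm a b, sort_pair h, sort_pair h', levList_pair_swap a b,
        levList_pair_of_lt h, levList_pair_of_lt h']
      simp [hab]
    · rw [levList_pair_self]; lia
    · rw [Finset.pair_comm a b, Finset.pair_comm c d, sort_pair h, sort_pair h',
        levList_pair_swap a b, levList_pair_swap c d, levList_pair_of_lt h, levList_pair_of_lt h']
      simp [hab, hcd']

lemma Ebr_wedge_wedge (a b c d : Fin 5) (f g : MvPolynomial (Fin 5) 𝔽) :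
    Ebr 𝔽 (wedge 𝔽 a b f) (wedge 𝔽 c d g) =
      ∑ t, (levList [a, b, c, d, t] : 𝔽) • vecField 𝔽 t (f * g) := by
  induction f using MvPolynomial.induction_on' with
  | add p q hp hq =>
    simp only [map_add, LinearMap.add_apply, hp, hq, add_mul, smul_add, Finset.sum_add_distrib]
  | monomial M u =>
    induction g using MvPolynomial.induction_on' with
    | add p q hp hq => simp only [map_add, hp, hq, mul_add, smul_add, Finset.sum_add_distrib]
    | monomial N v =>
      simp only [monomial_mul, vecField, wedge, keyForm, polyLift_monomial, map_smul,
        LinearMap.smul_apply, Ebr, biext_single, Ebval, Finset.smul_sum, smul_smul,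
        ← levList_mul_levList a b c d]
      refine Finset.sum_congr rfl fun t _ => ?_
      push_cast
      congr 1
      ring

/-- The image of `a_{ij} f` in `E(5,10)`. -/
noncomputable def phiA (i j : Fin 5) (f : MvPolynomial (Fin 5) 𝔽) : EAmb 𝔽 :=
  vecField 𝔽 i (pderiv j f) - vecField 𝔽 j (pderiv i f)

/-- The image of `b_k f` in `E(5,10)`. -/
noncomputable def phiB (k : Fin 5) (f : MvPolynomial (Fin 5) 𝔽) : EAmb 𝔽 :=
  ∑ t, wedge 𝔽 k t (pderiv t f)

/-- The map `Φ` on the free module on the spanning symbols. -/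
noncomputable def phiFree : AnnFree 𝔽 →ₗ[𝔽] EAmb 𝔽 :=
  Finsupp.linearCombination 𝔽 fun s : AnnSym =>
    match s with
    | (Sum.inl (i, j), M) => phiA 𝔽 i j (monomial M 1)
    | (Sum.inr k, M) => phiB 𝔽 k (monomial M 1)

lemma pderiv_monomial_one (i : Fin 5) (M : Exp5) :
    pderiv i (monomial M (1 : 𝔽)) = (M i : 𝔽) • monomial (M - single i 1) 1 := by
  simp [smul_monomial]

lemma phiA_smul (i j : Fin 5) (c : 𝔽) (f : MvPolynomial (Fin 5) 𝔽) :
    phiA 𝔽 i j (c • f) = c • phiA 𝔽 i j f := by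
  simp only [phiA, map_smul, Derivation.map_smul, smul_sub]

lemma phiB_smul (k : Fin 5) (c : 𝔽) (f : MvPolynomial (Fin 5) 𝔽) :
    phiB 𝔽 k (c • f) = c • phiB 𝔽 k f := by
  simp only [phiB, map_smul, Derivation.map_smul, Finset.smul_sum]

lemma sum_wedge_symm {u : Fin 5 → Fin 5 → MvPolynomial (Fin 5) 𝔽} (h : ∀ i j, u i j = u j i) :
    ∑ i, ∑ j, wedge 𝔽 i j (u i j) = 0 := by
  have h2 : ∑ i, ∑ j, wedge 𝔽 i j (u i j) = -∑ i, ∑ j, wedge 𝔽 i j (u i j) := by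
    conv_lhs => rw [Finset.sum_comm]
    simp only [← Finset.sum_neg_distrib]
    refine Finset.sum_congr rfl fun i _ => Finset.sum_congr rfl fun j _ => ?_
    rw [wedge_swap 𝔽 j i, h j i, LinearMap.neg_apply]
  exact self_eq_neg.1 h2

lemma annRels_le_ker : annRels 𝔽 ≤ LinearMap.ker (phiFree 𝔽) := by
  rw [annRels, Submodule.span_le]
  rintro _ ((⟨⟨⟨i, j⟩, M⟩, rfl⟩ | ⟨⟨⟨h, i, j⟩, M⟩, rfl⟩) | ⟨M, rfl⟩) <;>
    rw [SetLike.mem_coe, LinearMap.mem_ker]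
  · simp [relSkew, phiFree, phiA]
  · simp only [relCyc, phiFree, map_add, map_smul, Finsupp.linearCombination_single, one_smul,
      ← phiA_smul, ← pderiv_monomial_one]
    simp only [phiA]
    rw [pderiv_comm' 𝔽 j h, pderiv_comm' 𝔽 i h, pderiv_comm' 𝔽 j i]
    abel
  · simp only [relDiv, phiFree, map_sum, map_smul, Finsupp.linearCombination_single, one_smul,
      ← phiB_smul, ← pderiv_monomial_one]
    exact sum_wedge_symm 𝔽 fun i j => pderiv_comm' 𝔽 _ _ _

/-- The map `Φ : g(RE(5,10)) → E(5,10)`, with values in the ambient space. -/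
noncomputable def phi : AnnRE 𝔽 →ₗ[𝔽] EAmb 𝔽 :=
  (annRels 𝔽).liftQ (phiFree 𝔽) (annRels_le_ker 𝔽)

lemma phi_aSym (i j : Fin 5) (M : Exp5) :
    phi 𝔽 (aSym 𝔽 i j M) = phiA 𝔽 i j (monomial M 1) := by
  simp [phi, aSym, phiFree]

lemma phi_bSym (k : Fin 5) (M : Exp5) : phi 𝔽 (bSym 𝔽 k M) = phiB 𝔽 k (monomial M 1) := by
  simp [phi, bSym, phiFree]

lemma phi_aPoly (i j : Fin 5) (f : MvPolynomial (Fin 5) 𝔽) :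
    phi 𝔽 (aPoly 𝔽 i j f) = phiA 𝔽 i j f := by
  induction f using MvPolynomial.induction_on' with
  | add p q hp hq => simp only [map_add, hp, hq, phiA]; abel
  | monomial M c =>
    rw [aPoly, polyLift_monomial, map_smul, phi_aSym, ← phiA_smul, smul_monomial, smul_eq_mul,
      mul_one]

lemma phi_bPoly (k : Fin 5) (f : MvPolynomial (Fin 5) 𝔽) :
    phi 𝔽 (bPoly 𝔽 k f) = phiB 𝔽 k f := by
  induction f using MvPolynomial.induction_on' with
  | add p q hp hq => simp only [map_add, hp, hq, phiB, Finset.sum_add_distrib]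
  | monomial M c =>
    rw [bPoly, polyLift_monomial, map_smul, phi_bSym, ← phiB_smul, smul_monomial, smul_eq_mul,
      mul_one]

lemma tsub_single_apply_cast {M : Exp5} {j : Fin 5} (r : Fin 5) (h : M j ≠ 0) :
    ((M - single j 1 : Exp5) r : ℤ) = (M r : ℤ) - if j = r then 1 else 0 := by
  by_cases hr : j = r
  · subst hr
    simp; lia
  · simp [hr]

section
variable {C : Type} [AddCommGroup C] [Module 𝔽 C] (v : Exp5 → C)

lemma polyLift_pderiv_pderiv_mul (j r : Fin 5) (M N : Exp5) :
    polyLift 𝔽 v (pderiv r (pderiv j (monomial M 1)) * monomial N 1) =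
      (((M j : ℤ) * ((M r : ℤ) - if j = r then 1 else 0) : ℤ) : 𝔽) •
        v (M - single j 1 - single r 1 + N) := by
  by_cases h : M j = 0
  · simp [h]
  · rw [← tsub_single_apply_cast r h]
    simp only [pderiv_monomial, monomial_mul, polyLift_monomial]
    simp only [Int.cast_mul, Int.cast_natCast, one_mul, mul_one]

lemma polyLift_pderiv_mul (i : Fin 5) (M N : Exp5) :
    polyLift 𝔽 v (pderiv i (monomial M 1) * monomial N 1) =
      (M i : 𝔽) • v (M - single i 1 + N) := by
  simp [pderiv_monomial, monomial_mul, polyLift_monomial]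

lemma polyLift_pderiv_mul_pderiv (i j : Fin 5) (M N : Exp5) :
    polyLift 𝔽 v (pderiv j (pderiv i (monomial M 1) * monomial N 1)) =
      (((M i : ℤ) * (((M + N) j : ℤ) - if i = j then 1 else 0) : ℤ) : 𝔽) •
        v (M + N - single i 1 - single j 1) := by
  by_cases h : M i = 0
  · simp [h]
  · have h' : (M + N) i ≠ 0 := by simp [h]
    have e : M - single i 1 + N = M + N - single i 1 := by
      rw [add_comm M N, add_tsub_single 𝔽 (by exact_mod_cast h), add_comm]
    rw [← tsub_single_apply_cast j h']
    simp only [pderiv_monomial, monomial_mul, polyLift_monomial, e]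
    simp only [Int.cast_mul, Int.cast_natCast, one_mul, mul_one]

lemma polyLift_pderiv_pderiv_mul' (j r : Fin 5) (M N : Exp5) :
    polyLift 𝔽 v (pderiv r (pderiv j (monomial M 1)) * monomial N 1) =
      (((M j : ℤ) * ((M r : ℤ) - if j = r then 1 else 0) : ℤ) : 𝔽) •
        v (M + N - single j 1 - single r 1) := by
  rw [polyLift_pderiv_pderiv_mul]
  refine smul_congr_of_ne_zero 𝔽 fun h => ?_
  have h1 : M j ≠ 0 := fun h0 => h (by simp [h0])
  rw [← tsub_single_apply_cast r h1] at h
  have h2 : (M - single j 1 : Exp5) r ≠ 0 := fun h0 => h (by simp [h0])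
  rw [add_comm M N, add_tsub_single 𝔽 (by exact_mod_cast h1),
    add_tsub_single 𝔽 (by exact_mod_cast h2), add_comm]

end

lemma aPoly_eq (i j : Fin 5) : aPoly 𝔽 i j = polyLift 𝔽 (aSym 𝔽 i j) := rfl

lemma bPoly_eq (k : Fin 5) : bPoly 𝔽 k = polyLift 𝔽 (bSym 𝔽 k) := rfl

lemma Ebr_phiA_phiA (i j r s : Fin 5) (f g : MvPolynomial (Fin 5) 𝔽) :
    Ebr 𝔽 (phiA 𝔽 i j f) (phiA 𝔽 r s g) =
      phiA 𝔽 s i (pderiv r (pderiv j f) * g) + phiA 𝔽 j s (pderiv r (pderiv i f) * g) +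
        phiA 𝔽 r j (pderiv s (pderiv i f) * g) + phiA 𝔽 i r (pderiv s (pderiv j f) * g) -
        phiA 𝔽 r s (pderiv j (pderiv i f * g)) - phiA 𝔽 s r (pderiv i (pderiv j f * g)) := by
  simp only [phiA, map_sub, LinearMap.sub_apply, Ebr_vec_vec, pderiv_mul, map_add]
  rw [pderiv_comm' 𝔽 i r g, pderiv_comm' 𝔽 j r g, pderiv_comm' 𝔽 i s g, pderiv_comm' 𝔽 j s g,
    pderiv_comm' 𝔽 j i f, pderiv_comm' 𝔽 i r (pderiv j f), pderiv_comm' 𝔽 j r (pderiv i f),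
    pderiv_comm' 𝔽 i s (pderiv j f), pderiv_comm' 𝔽 j s (pderiv i f),
    pderiv_comm' 𝔽 j i f, pderiv_comm' 𝔽 s r (pderiv j f), pderiv_comm' 𝔽 s r (pderiv i f),
    mul_comm (pderiv s g), mul_comm (pderiv s g), mul_comm (pderiv r g), mul_comm (pderiv r g)]
  abel

lemma phi_gaa (i j : Fin 5) (M : Exp5) (r s : Fin 5) (N : Exp5) :
    phi 𝔽 (gaa 𝔽 i j M r s N) =
      Ebr 𝔽 (phi 𝔽 (aSym 𝔽 i j M)) (phi 𝔽 (aSym 𝔽 r s N)) := by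
  have e := polyLift_pderiv_mul_pderiv 𝔽 (aSym 𝔽 s r) j i M N
  rw [tsub_right_comm] at e
  simp only [eq_comm (a := j) (b := i)] at e
  simp only [gaa, ← polyLift_pderiv_pderiv_mul, ← polyLift_pderiv_mul_pderiv, ← e]
  simp only [← aPoly_eq, phi_aSym, map_add, map_sub, phi_aPoly, Ebr_phiA_phiA]

lemma Ebr_vec_phiB (i k : Fin 5) (u g : MvPolynomial (Fin 5) 𝔽) :
    Ebr 𝔽 (vecField 𝔽 i u) (phiB 𝔽 k g) =
      phiB 𝔽 k (u * pderiv i g) + if i = k then ∑ h, phiB 𝔽 h (pderiv h u * g) else 0 := by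
  have h1 : ∑ h, phiB 𝔽 h (pderiv h u * g) =
      ∑ t, ∑ h, wedge 𝔽 h t (pderiv t g * pderiv h u) := by
    rw [Finset.sum_comm]
    simp only [phiB, pderiv_mul, map_add, Finset.sum_add_distrib, mul_comm (pderiv _ g)]
    rw [add_eq_right]
    exact sum_wedge_symm 𝔽 fun a b => by rw [pderiv_comm' 𝔽 a b]
  rw [h1]
  generalize hw : ∑ t, ∑ h, wedge 𝔽 h t (pderiv t g * pderiv h u) = w
  have h2 : ∑ t, wedge 𝔽 k t (u * pderiv i (pderiv t g)) =
      ∑ t, wedge 𝔽 k t (u * pderiv t (pderiv i g)) :=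
    Finset.sum_congr rfl fun t _ => by rw [pderiv_comm' 𝔽 i t]
  simp only [phiB, map_sum, Ebr_vec_wedge, Finset.sum_add_distrib, pderiv_mul, map_add,
    Finset.sum_ite_eq, Finset.mem_univ, if_true, h2, mul_comm (pderiv i g)]
  by_cases h : i = k
  · simp only [h, if_true, hw]
    abel
  · simp only [h, if_false, Finset.sum_const_zero]
    abel

lemma phi_gab (i j : Fin 5) (M : Exp5) (k : Fin 5) (N : Exp5) :
    phi 𝔽 (gab 𝔽 i j M k N) =
      Ebr 𝔽 (phi 𝔽 (aSym 𝔽 i j M)) (phi 𝔽 (bSym 𝔽 k N)) := by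
  have e := polyLift_pderiv_mul_pderiv 𝔽 (bSym 𝔽 k) j i M N
  rw [tsub_right_comm] at e
  simp only [eq_comm (a := j) (b := i)] at e
  rw [gab, Int.cast_add, Int.cast_neg, add_smul, neg_smul, ← e, ← polyLift_pderiv_mul_pderiv]
  simp only [← polyLift_pderiv_pderiv_mul', ← bPoly_eq]
  rw [phi_aSym, phi_bSym, phiA, map_sub (Ebr 𝔽), LinearMap.sub_apply, Ebr_vec_phiB, Ebr_vec_phiB]
  simp only [map_add, map_sub, map_neg, phi_bPoly, apply_ite (phi 𝔽), map_sum, map_zero]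
  have h : ∀ f g : MvPolynomial (Fin 5) 𝔽,
      -phiB 𝔽 k (pderiv j (pderiv i f * g)) + phiB 𝔽 k (pderiv i (pderiv j f * g)) =
        phiB 𝔽 k (pderiv j f * pderiv i g) - phiB 𝔽 k (pderiv i f * pderiv j g) := by
    intro f g
    simp only [phiB, pderiv_mul, map_add, Finset.sum_add_distrib, pderiv_comm' 𝔽 i j f]
    abel
  rw [h]
  abel

lemma sum_antisymm {C : Type} [AddCommGroup C] [Module 𝔽 C] {u : Fin 5 → Fin 5 → C}
    (h : ∀ i j, u i j = -u j i) : ∑ i, ∑ j, u i j = 0 := by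
  have h2 : ∑ i, ∑ j, u i j = -∑ i, ∑ j, u i j := by
    conv_lhs => rw [Finset.sum_comm]
    simp only [← Finset.sum_neg_distrib]
    exact Finset.sum_congr rfl fun i _ => Finset.sum_congr rfl fun j _ => h j i
  rw [eq_neg_iff_add_eq_zero, ← two_smul 𝔽] at h2
  exact (smul_eq_zero.1 h2).resolve_left two_ne_zero

lemma phi_gbb (i : Fin 5) (M : Exp5) (j : Fin 5) (N : Exp5) :
    phi 𝔽 (gbb 𝔽 i M j N) =
      Ebr 𝔽 (phi 𝔽 (bSym 𝔽 i M)) (phi 𝔽 (bSym 𝔽 j N)) := by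
  simp only [gbb, ← polyLift_pderiv_mul, ← aPoly_eq, phi_bSym, map_smul, map_sum, phi_aPoly]
  generalize (monomial M (1 : 𝔽)) = f
  generalize (monomial N (1 : 𝔽)) = g
  have h1 : ∀ h, ∑ k, ∑ l, (levList [i, j, h, k, l] : 𝔽) • phiA 𝔽 k l (pderiv h f * g) =
      (2 : 𝔽) • ∑ k, ∑ l, (levList [i, j, h, k, l] : 𝔽) •
        vecField 𝔽 k (pderiv l (pderiv h f * g)) := by
    intro h
    simp only [phiA, smul_sub, Finset.sum_sub_distrib]
    rw [two_smul, sub_eq_iff_eq_add, add_assoc, left_eq_add]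
    conv => enter [1, 2]; rw [Finset.sum_comm]
    simp only [← Finset.sum_add_distrib, ← add_smul]
    refine Finset.sum_eq_zero fun k _ => Finset.sum_eq_zero fun l _ => ?_
    have := levList_append_swap [i, j, h] [] k l
    simp only [List.cons_append, List.nil_append] at this
    simp [this]
  simp only [h1, ← Finset.smul_sum]
  rw [smul_smul, inv_mul_cancel₀ two_ne_zero, one_smul]
  simp only [phiB, map_sum, LinearMap.sum_apply, Ebr_wedge_wedge, pderiv_mul, map_add, smul_add,
    Finset.sum_add_distrib]
  have h2 : ∑ h, ∑ k, ∑ l, (levList [i, j, h, k, l] : 𝔽) •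
      vecField 𝔽 k (pderiv l (pderiv h f) * g) = 0 := by
    rw [Finset.sum_comm]
    refine Finset.sum_eq_zero fun k _ => sum_antisymm 𝔽 fun h l => ?_
    have e1 := levList_append_swap [i, j] [l] h k
    have e2 := levList_append_swap [i, j, k] [] h l
    have e3 := levList_append_swap [i, j] [h] k l
    simp only [List.cons_append, List.nil_append] at e1 e2 e3
    rw [e1, e2, e3, pderiv_comm' 𝔽 l h]
    simp
  rw [h2, zero_add]
  conv_rhs => rw [Finset.sum_comm]
  refine Finset.sum_congr rfl fun h _ => ?_
  rw [Finset.sum_comm]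
  refine Finset.sum_congr rfl fun l _ => Finset.sum_congr rfl fun k _ => ?_
  have e1 := levList_append_swap [i] [k, l] j h
  have e2 := levList_append_swap [i, h, j] [] k l
  simp only [List.cons_append, List.nil_append] at e1 e2
  rw [e1, e2, neg_neg]

lemma Ebval_swap_vec_form (i : Fin 5) (M : Exp5) (S : Finset (Fin 5)) (N : Exp5) :
    Ebval 𝔽 (Sum.inr (S, N)) (Sum.inl (i, M)) = -Ebval 𝔽 (Sum.inl (i, M)) (Sum.inr (S, N)) :=
  rfl

lemma Ebr_wedge_vec (i a b : Fin 5) (f g : MvPolynomial (Fin 5) 𝔽) :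
    Ebr 𝔽 (wedge 𝔽 a b g) (vecField 𝔽 i f) = -Ebr 𝔽 (vecField 𝔽 i f) (wedge 𝔽 a b g) := by
  induction f using MvPolynomial.induction_on' with
  | add p q hp hq => simp only [map_add, LinearMap.add_apply, hp, hq, neg_add]
  | monomial M u =>
    induction g using MvPolynomial.induction_on' with
    | add p q hp hq => simp only [map_add, LinearMap.add_apply, hp, hq, neg_add]
    | monomial N v =>
      simp only [vecField, wedge, keyForm, polyLift_monomial, map_smul,
        LinearMap.smul_apply, Ebr, biext_single, Ebval_swap_vec_form, smul_neg]
      rw [smul_comm u, smul_comm u]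

lemma Ebr_phiB_vec (i k : Fin 5) (f g : MvPolynomial (Fin 5) 𝔽) :
    Ebr 𝔽 (phiB 𝔽 k g) (vecField 𝔽 i f) = -Ebr 𝔽 (vecField 𝔽 i f) (phiB 𝔽 k g) := by
  simp only [phiB, map_sum, LinearMap.sum_apply, Ebr_wedge_vec, Finset.sum_neg_distrib]

lemma phi_gab_swap (i j : Fin 5) (M : Exp5) (k : Fin 5) (N : Exp5) :
    phi 𝔽 (-gab 𝔽 i j M k N) =
      Ebr 𝔽 (phi 𝔽 (bSym 𝔽 k N)) (phi 𝔽 (aSym 𝔽 i j M)) := by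
  rw [map_neg, phi_gab, phi_aSym, phi_bSym, phiA, map_sub (Ebr 𝔽), LinearMap.sub_apply,
    map_sub, Ebr_phiB_vec, Ebr_phiB_vec]
  abel

/-- Linear maps out of `g(RE(5,10))` agreeing on the symbols are equal. -/
lemma annRE_hom_ext {C : Type} [AddCommGroup C] [Module 𝔽 C] {u v : AnnRE 𝔽 →ₗ[𝔽] C}
    (ha : ∀ i j M, u (aSym 𝔽 i j M) = v (aSym 𝔽 i j M))
    (hb : ∀ k M, u (bSym 𝔽 k M) = v (bSym 𝔽 k M)) : u = v := by
  refine Submodule.linearMap_qext _ (Finsupp.lhom_ext' fun s => LinearMap.ext_ring ?_)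
  obtain ⟨⟨i, j⟩ | k, M⟩ := s
  · exact ha i j M
  · exact hb k M

lemma phi_bracket (bA : AnnRE 𝔽 →ₗ[𝔽] AnnRE 𝔽 →ₗ[𝔽] AnnRE 𝔽)
    (haa : ∀ i j M rr ss N, bA (aSym 𝔽 i j M) (aSym 𝔽 rr ss N) = gaa 𝔽 i j M rr ss N)
    (hab : ∀ i j M k N, bA (aSym 𝔽 i j M) (bSym 𝔽 k N) = gab 𝔽 i j M k N)
    (hba : ∀ i j M k N, bA (bSym 𝔽 k N) (aSym 𝔽 i j M) = -gab 𝔽 i j M k N)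
    (hbb : ∀ i M j N, bA (bSym 𝔽 i M) (bSym 𝔽 j N) = gbb 𝔽 i M j N) (x y : AnnRE 𝔽) :
    phi 𝔽 (bA x y) = Ebr 𝔽 (phi 𝔽 x) (phi 𝔽 y) := by
  have h : bA.compr₂ (phi 𝔽) = (Ebr 𝔽).compl₁₂ (phi 𝔽) (phi 𝔽) := by
    refine annRE_hom_ext 𝔽 (fun i j M => annRE_hom_ext 𝔽 (fun r s N => ?_) fun k N => ?_)
      fun k M => annRE_hom_ext 𝔽 (fun r s N => ?_) fun l N => ?_
    · simp [haa, phi_gaa]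
    · simp [hab, phi_gab]
    · simpa [hba] using phi_gab_swap 𝔽 r s N k M
    · simp [hbb, phi_gbb]
  exact LinearMap.congr_fun₂ h x y

lemma pderiv_eulerInv (c : ℕ) (i : Fin 5) (f : MvPolynomial (Fin 5) 𝔽) :
    pderiv i (eulerInv 𝔽 c f) = eulerInv 𝔽 (c + 1) (pderiv i f) := by
  induction f using MvPolynomial.induction_on' with
  | add p q hp hq => simp only [map_add, hp, hq]
  | monomial M u =>
    simp only [eulerInv, polyLift_monomial, pderiv_monomial, smul_monomial, smul_eq_mul]
    by_cases h : M i = 0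
    · simp [h]
    · have e : (M - single i 1).degree + 1 = M.degree := by
        have h1 : single i 1 ≤ M := by
          rw [Finsupp.single_le_iff]
          exact Nat.one_le_iff_ne_zero.2 h
        conv_rhs => rw [← tsub_add_cancel_of_le h1]
        rw [map_add, Finsupp.degree_single]
      rw [← e, add_assoc, add_comm 1 c]
      congr 1
      ring

lemma euler_eulerInv {c : ℕ} (hc : c ≠ 0) (f : MvPolynomial (Fin 5) 𝔽) :
    ∑ j, X j * pderiv j (eulerInv 𝔽 c f) + (c : 𝔽) • eulerInv 𝔽 c f = f := by
  induction f using MvPolynomial.induction_on' with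
  | add p q hp hq =>
    conv_rhs => rw [← hp, ← hq]
    simp only [map_add, mul_add, Finset.sum_add_distrib, smul_add]
    abel
  | monomial M u =>
    simp only [eulerInv, polyLift_monomial, smul_monomial, smul_eq_mul, X_mul_pderiv_monomial]
    rw [← map_sum, ← Finset.sum_smul, ← Finsupp.degree_eq_sum, ← Nat.cast_smul_eq_nsmul 𝔽,
      ← map_add, smul_eq_mul, ← add_mul, ← Nat.cast_add, mul_left_comm, mul_inv_cancel₀, mul_one]
    exact_mod_cast fun h => hc (by lia)

lemma aPoly_skew (i j : Fin 5) (f : MvPolynomial (Fin 5) 𝔽) :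
    aPoly 𝔽 i j f = -aPoly 𝔽 j i f := by
  rw [eq_neg_iff_add_eq_zero]
  induction f using MvPolynomial.induction_on' with
  | add p q hp hq =>
    rw [map_add, map_add, add_add_add_comm, hp, hq, add_zero]
  | monomial M u =>
    simp only [aPoly, polyLift_monomial, ← smul_add, aSym]
    rw [← Submodule.Quotient.mk_add, (Submodule.Quotient.mk_eq_zero _).2, smul_zero]
    exact Submodule.subset_span (Or.inl (Or.inl ⟨((i, j), M), rfl⟩))

lemma aPoly_cyc (h i j : Fin 5) (f : MvPolynomial (Fin 5) 𝔽) :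
    aPoly 𝔽 i j (pderiv h f) + aPoly 𝔽 j h (pderiv i f) + aPoly 𝔽 h i (pderiv j f) = 0 := by
  induction f using MvPolynomial.induction_on' with
  | add p q hp hq =>
    simp only [map_add]
    linear_combination (norm := module) hp + hq
  | monomial M u =>
    simp only [aPoly, pderiv_monomial, polyLift_monomial, mul_smul, ← smul_add, aSym,
      ← Submodule.Quotient.mk_smul, ← Submodule.Quotient.mk_add]
    rw [(Submodule.Quotient.mk_eq_zero _).2]
    exact Submodule.smul_mem _ _ (Submodule.subset_span (Or.inl (Or.inr ⟨((h, i, j), M), rfl⟩)))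

lemma bPoly_div (f : MvPolynomial (Fin 5) 𝔽) : ∑ k, bPoly 𝔽 k (pderiv k f) = 0 := by
  induction f using MvPolynomial.induction_on' with
  | add p q hp hq => simp only [map_add, Finset.sum_add_distrib, hp, hq, add_zero]
  | monomial M u =>
    simp only [bPoly, pderiv_monomial, polyLift_monomial, mul_smul, ← Finset.smul_sum]
    have h : ∑ k, (M k : 𝔽) • bSym 𝔽 k (M - single k 1) =
        Submodule.Quotient.mk (p := annRels 𝔽) (relDiv 𝔽 M) := by
      rw [← Submodule.mkQ_apply, relDiv, map_sum]
      rfl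
    rw [h, (Submodule.Quotient.mk_eq_zero _).2, smul_zero]
    exact Submodule.subset_span (Or.inr ⟨M, rfl⟩)

/-- The preimage of the vector field `f ∂_{x_i}` under the homotopy. -/
noncomputable def psiVec (i : Fin 5) : MvPolynomial (Fin 5) 𝔽 →ₗ[𝔽] AnnRE 𝔽 :=
  ∑ j, aPoly 𝔽 i j ∘ₗ LinearMap.mulLeft 𝔽 (X j) ∘ₗ eulerInv 𝔽 4

/-- The preimage of the 2-form `f dx_a ∧ dx_b` under the homotopy. -/
noncomputable def psiForm (a b : Fin 5) : MvPolynomial (Fin 5) 𝔽 →ₗ[𝔽] AnnRE 𝔽 :=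
  bPoly 𝔽 a ∘ₗ LinearMap.mulLeft 𝔽 (X b) ∘ₗ eulerInv 𝔽 2 -
    bPoly 𝔽 b ∘ₗ LinearMap.mulLeft 𝔽 (X a) ∘ₗ eulerInv 𝔽 2

lemma psiVec_apply (i : Fin 5) (f : MvPolynomial (Fin 5) 𝔽) :
    psiVec 𝔽 i f = ∑ j, aPoly 𝔽 i j (X j * eulerInv 𝔽 4 f) := by
  simp [psiVec]

lemma psiForm_apply (a b : Fin 5) (f : MvPolynomial (Fin 5) 𝔽) :
    psiForm 𝔽 a b f =
      bPoly 𝔽 a (X b * eulerInv 𝔽 2 f) - bPoly 𝔽 b (X a * eulerInv 𝔽 2 f) := by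
  simp [psiForm]

/-- The left inverse of `Φ`, defined on the whole ambient space by the Poincaré homotopy. -/
noncomputable def psi : EAmb 𝔽 →ₗ[𝔽] AnnRE 𝔽 :=
  Finsupp.linearCombination 𝔽 fun k : EKey =>
    match k with
    | Sum.inl (i, N) => psiVec 𝔽 i (monomial N 1)
    | Sum.inr (S, N) =>
        (2 : 𝔽)⁻¹ • ∑ a ∈ S, ∑ b ∈ S, (levList [a, b] : 𝔽) • psiForm 𝔽 a b (monomial N 1)

lemma psi_vecField (i : Fin 5) (f : MvPolynomial (Fin 5) 𝔽) :
    psi 𝔽 (vecField 𝔽 i f) = psiVec 𝔽 i f := by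
  refine LinearMap.congr_fun (f := psi 𝔽 ∘ₗ vecField 𝔽 i) (poly_hom_ext 𝔽 fun N => ?_) f
  simp [vecField, polyLift_monomial, psi]

lemma levList_pair_mul_self {a b : Fin 5} (h : a ≠ b) : levList [a, b] * levList [a, b] = 1 := by
  rcases lt_or_gt_of_ne h with h | h
  · rw [levList_pair_of_lt h, one_mul]
  · rw [levList_pair_swap, levList_pair_of_lt h]; rfl

lemma psiForm_swap (a b : Fin 5) : psiForm 𝔽 a b = -psiForm 𝔽 b a := by
  simp [psiForm]

lemma psi_wedge (a b : Fin 5) (f : MvPolynomial (Fin 5) 𝔽) :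
    psi 𝔽 (wedge 𝔽 a b f) = psiForm 𝔽 a b f := by
  refine LinearMap.congr_fun (f := psi 𝔽 ∘ₗ wedge 𝔽 a b) (poly_hom_ext 𝔽 fun N => ?_) f
  by_cases h : a = b
  · subst h
    simp [wedge_self, psiForm]
  · have h2 : (levList [a, b] : 𝔽) * levList [a, b] = 1 := by
      exact_mod_cast congrArg (Int.cast : ℤ → 𝔽) (levList_pair_mul_self h)
    simp only [LinearMap.comp_apply, wedge, keyForm, LinearMap.smul_apply, polyLift_monomial, psi,
      map_smul, Finsupp.linearCombination_single, one_smul, Finset.sum_pair h, levList_pair_self,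
      Int.cast_zero, zero_smul, zero_add, add_zero, levList_pair_swap b a, psiForm_swap 𝔽 b a,
      LinearMap.neg_apply, Int.cast_neg, neg_smul, smul_neg, neg_neg, ← two_smul 𝔽]
    rw [smul_smul (2 : 𝔽)⁻¹, inv_mul_cancel₀ two_ne_zero, one_smul, smul_smul, h2, one_smul]

lemma psi_phiA (i j : Fin 5) (f : MvPolynomial (Fin 5) 𝔽) :
    psi 𝔽 (phiA 𝔽 i j f) = aPoly 𝔽 i j f := by
  rw [phiA, map_sub, psi_vecField, psi_vecField, psiVec_apply, psiVec_apply]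
  simp only [← pderiv_eulerInv 𝔽 3]
  have h := Finset.sum_eq_zero fun k (_ : k ∈ Finset.univ) =>
    aPoly_cyc 𝔽 k i j (X k * eulerInv 𝔽 3 f)
  conv_rhs => rw [← euler_eulerInv 𝔽 three_ne_zero f]
  generalize eulerInv 𝔽 3 f = g at *
  simp only [pderiv_mul, pderiv_X, Pi.single_apply, map_add, Finset.sum_add_distrib, ite_mul,
    one_mul, zero_mul, if_true, apply_ite (aPoly 𝔽 _ _), map_zero,
    Finset.sum_ite_eq', Finset.mem_univ, Finset.sum_const, Finset.card_univ, Fintype.card_fin,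
    aPoly_skew 𝔽 _ i, Finset.sum_neg_distrib] at h
  simp only [map_add, map_sum, map_smul]
  push_cast
  linear_combination (norm := module) -h

lemma psi_phiB (k : Fin 5) (f : MvPolynomial (Fin 5) 𝔽) :
    psi 𝔽 (phiB 𝔽 k f) = bPoly 𝔽 k f := by
  simp only [phiB, map_sum, psi_wedge, psiForm_apply, ← pderiv_eulerInv 𝔽 1]
  have h := bPoly_div 𝔽 (X k * eulerInv 𝔽 1 f)
  conv_rhs => rw [← euler_eulerInv 𝔽 one_ne_zero f]
  generalize eulerInv 𝔽 1 f = g at *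
  simp only [pderiv_mul, pderiv_X, Pi.single_apply, map_add, Finset.sum_add_distrib, ite_mul,
    one_mul, zero_mul, apply_ite (bPoly 𝔽 _), map_zero, Finset.sum_ite_eq,
    Finset.mem_univ, if_true] at h
  rw [map_add, map_sum, Nat.cast_one, one_smul, Finset.sum_sub_distrib, sub_eq_add_neg,
    neg_eq_of_add_eq_zero_left h]

lemma psi_phi (x : AnnRE 𝔽) : psi 𝔽 (phi 𝔽 x) = x := by
  refine LinearMap.congr_fun (f := psi 𝔽 ∘ₗ phi 𝔽) (g := LinearMap.id)
    (annRE_hom_ext 𝔽 (fun i j M => ?_) fun k M => ?_) x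
  · simp [phi_aSym, psi_phiA, aPoly, polyLift_monomial]
  · simp [phi_bSym, psi_phiB, bPoly, polyLift_monomial]

lemma divMap_vecField (i : Fin 5) (f : MvPolynomial (Fin 5) 𝔽) :
    divMap 𝔽 (vecField 𝔽 i f) = polyFun 𝔽 (pderiv i f) := by
  refine LinearMap.congr_fun (f := divMap 𝔽 ∘ₗ vecField 𝔽 i)
    (g := polyFun 𝔽 ∘ₗ (pderiv i).toLinearMap) (poly_hom_ext 𝔽 fun N => ?_) f
  simp [vecField, polyFun, polyLift_monomial, divMap]

lemma divMap_wedge (a b : Fin 5) (f : MvPolynomial (Fin 5) 𝔽) :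
    divMap 𝔽 (wedge 𝔽 a b f) = 0 := by
  refine LinearMap.congr_fun (f := divMap 𝔽 ∘ₗ wedge 𝔽 a b) (g := 0)
    (poly_hom_ext 𝔽 fun N => ?_) f
  simp [wedge, keyForm, polyLift_monomial, divMap]

lemma dMap_vecField (i : Fin 5) (f : MvPolynomial (Fin 5) 𝔽) :
    dMap 𝔽 (vecField 𝔽 i f) = 0 := by
  refine LinearMap.congr_fun (f := dMap 𝔽 ∘ₗ vecField 𝔽 i) (g := 0)
    (poly_hom_ext 𝔽 fun N => ?_) f
  simp [vecField, polyLift_monomial, dMap]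

lemma dMap_wedge_of_lt {a b : Fin 5} (h : a < b) (f : MvPolynomial (Fin 5) 𝔽) :
    dMap 𝔽 (wedge 𝔽 a b f) =
      ∑ h, (levList [h, a, b] : 𝔽) • keyForm3 𝔽 {h, a, b} (pderiv h f) := by
  induction f using MvPolynomial.induction_on' with
  | add p q hp hq => simp only [map_add, hp, hq, smul_add, Finset.sum_add_distrib]
  | monomial N c =>
    rw [wedge_of_lt 𝔽 h]
    simp only [keyForm, keyForm3, pderiv_monomial, polyLift_monomial, dMap, map_smul,
      Finsupp.lsum_single, LinearMap.toSpanSingleton_apply, Finset.smul_sum, smul_smul,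
      sort_pair h]
    refine Finset.sum_congr rfl fun t _ => ?_
    congr 1
    ring

lemma dMap_wedge (a b : Fin 5) (f : MvPolynomial (Fin 5) 𝔽) :
    dMap 𝔽 (wedge 𝔽 a b f) =
      ∑ h, (levList [h, a, b] : 𝔽) • keyForm3 𝔽 {h, a, b} (pderiv h f) := by
  have hs (t a b : Fin 5) : levList [t, a, b] = -levList [t, b, a] :=
    levList_append_swap [t] [] a b
  rcases lt_trichotomy a b with h | rfl | h
  · exact dMap_wedge_of_lt 𝔽 h f
  · have h0 (t : Fin 5) : levList [t, a, a] = 0 := by have := hs t a a; lia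
    simp [wedge_self, h0]
  · rw [wedge_swap, LinearMap.neg_apply, map_neg, dMap_wedge_of_lt 𝔽 h, ← Finset.sum_neg_distrib]
    refine Finset.sum_congr rfl fun t _ => ?_
    rw [hs t a b, Finset.pair_comm a b, Int.cast_neg, neg_smul]

lemma vecField_mem_supported (i : Fin 5) (f : MvPolynomial (Fin 5) 𝔽) :
    vecField 𝔽 i f ∈ Finsupp.supported 𝔽 𝔽 validKeys := by
  induction f using MvPolynomial.induction_on' with
  | add p q hp hq => rw [map_add]; exact add_mem hp hq
  | monomial N c =>
    rw [vecField, polyLift_monomial]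
    exact Submodule.smul_mem _ _ (Finsupp.single_mem_supported 𝔽 1 trivial)

lemma wedge_mem_supported (a b : Fin 5) (f : MvPolynomial (Fin 5) 𝔽) :
    wedge 𝔽 a b f ∈ Finsupp.supported 𝔽 𝔽 validKeys := by
  by_cases h : a = b
  · subst h
    simp [wedge_self]
  induction f using MvPolynomial.induction_on' with
  | add p q hp hq => rw [map_add]; exact add_mem hp hq
  | monomial N c =>
    rw [wedge, LinearMap.smul_apply, keyForm, polyLift_monomial]
    exact Submodule.smul_mem _ _ (Submodule.smul_mem _ _
      (Finsupp.single_mem_supported 𝔽 1 (Finset.card_pair h)))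

lemma phiA_mem_E510 (i j : Fin 5) (f : MvPolynomial (Fin 5) 𝔽) :
    phiA 𝔽 i j f ∈ E510 𝔽 := by
  refine ⟨⟨?_, ?_⟩, sub_mem (vecField_mem_supported 𝔽 _ _) (vecField_mem_supported 𝔽 _ _)⟩
  · simp [phiA, divMap_vecField, pderiv_comm' 𝔽 i j]
  · simp [phiA, dMap_vecField]

lemma phiB_mem_E510 (k : Fin 5) (f : MvPolynomial (Fin 5) 𝔽) : phiB 𝔽 k f ∈ E510 𝔽 := by
  refine ⟨⟨?_, ?_⟩, sum_mem fun t _ => wedge_mem_supported 𝔽 _ _ _⟩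
  · simp [phiB, divMap_wedge]
  · rw [SetLike.mem_coe, LinearMap.mem_ker, phiB, map_sum]
    simp only [dMap_wedge]
    refine sum_antisymm 𝔽 fun t h => ?_
    have e : levList [h, k, t] = -levList [t, k, h] := by
      have h1 := levList_append_swap [] [t] h k
      have h2 := levList_append_swap [k] [] h t
      have h3 := levList_append_swap [] [h] k t
      simp only [List.nil_append, List.cons_append] at h1 h2 h3
      lia
    have e' : ({h, k, t} : Finset (Fin 5)) = {t, k, h} := by
      ext; simp; tauto
    rw [e, e', pderiv_comm' 𝔽 h t, Int.cast_neg, neg_smul]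

lemma phi_mem_E510 (x : AnnRE 𝔽) : phi 𝔽 x ∈ E510 𝔽 := by
  rw [← Submodule.Quotient.mk_eq_zero]
  refine LinearMap.congr_fun (f := (E510 𝔽).mkQ ∘ₗ phi 𝔽) (g := 0)
    (annRE_hom_ext 𝔽 (fun i j M => ?_) fun k M => ?_) x
  · simpa [phi_aSym] using phiA_mem_E510 𝔽 i j _
  · simpa [phi_bSym] using phiB_mem_E510 𝔽 k _

/-- The Poincaré homotopy on divergences. -/
noncomputable def divHomotopy : (Exp5 →₀ 𝔽) →ₗ[𝔽] EAmb 𝔽 :=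
  Finsupp.linearCombination 𝔽 fun P : Exp5 =>
    ∑ j, vecField 𝔽 j (X j * eulerInv 𝔽 5 (monomial P 1))

lemma divHomotopy_polyFun (f : MvPolynomial (Fin 5) 𝔽) :
    divHomotopy 𝔽 (polyFun 𝔽 f) = ∑ j, vecField 𝔽 j (X j * eulerInv 𝔽 5 f) := by
  induction f using MvPolynomial.induction_on' with
  | add p q hp hq => simp only [map_add, mul_add, Finset.sum_add_distrib, hp, hq]
  | monomial P c =>
    rw [← mul_one c, ← smul_eq_mul, ← smul_monomial]
    simp only [map_smul, mul_smul_comm, ← Finset.smul_sum]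
    simp [polyFun, polyLift_monomial, divHomotopy]

/-- The contraction of `f dx_h ∧ dx_a ∧ dx_b` with the Euler vector field. -/
noncomputable def contract (h a b : Fin 5) (f : MvPolynomial (Fin 5) 𝔽) : EAmb 𝔽 :=
  wedge 𝔽 a b (X h * f) + wedge 𝔽 b h (X a * f) + wedge 𝔽 h a (X b * f)

/-- The Poincaré homotopy on 3-forms. -/
noncomputable def formHomotopy : ((Finset (Fin 5) × Exp5) →₀ 𝔽) →ₗ[𝔽] EAmb 𝔽 :=
  Finsupp.linearCombination 𝔽 fun p : Finset (Fin 5) × Exp5 =>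
    match p.1.sort (· ≤ ·) with
    | [h, a, b] => contract 𝔽 h a b (eulerInv 𝔽 3 (monomial p.2 1))
    | _ => 0

lemma sort_triple {h a b : Fin 5} (h1 : h < a) (h2 : a < b) :
    ({h, a, b} : Finset (Fin 5)).sort (· ≤ ·) = [h, a, b] := by
  rw [Finset.sort_insert, sort_pair h2]
  · simpa using ⟨h1.le, (h1.trans h2).le⟩
  · simpa using ⟨h1.ne, (h1.trans h2).ne⟩

lemma formHomotopy_keyForm3 {h a b : Fin 5} (h1 : h < a) (h2 : a < b)
    (f : MvPolynomial (Fin 5) 𝔽) :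
    formHomotopy 𝔽 (keyForm3 𝔽 {h, a, b} f) = contract 𝔽 h a b (eulerInv 𝔽 3 f) := by
  induction f using MvPolynomial.induction_on' with
  | add p q hp hq =>
    simp only [map_add, hp, hq, contract, mul_add]
    abel
  | monomial P c =>
    rw [← mul_one c, ← smul_eq_mul, ← smul_monomial]
    simp only [map_smul, contract, mul_smul_comm, ← smul_add]
    simp [keyForm3, polyLift_monomial, formHomotopy, sort_triple h1 h2, contract]

lemma levList_triple_of_lt {h a b : Fin 5} (h1 : h < a) (h2 : a < b) : levList [h, a, b] = 1 := by
  revert h a b; decide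

lemma smul_formHomotopy_keyForm3 (h : Fin 5) {a b : Fin 5} (hab : a < b)
    (f : MvPolynomial (Fin 5) 𝔽) :
    (levList [h, a, b] : 𝔽) • formHomotopy 𝔽 (keyForm3 𝔽 {h, a, b} f) =
      contract 𝔽 h a b (eulerInv 𝔽 3 f) := by
  rcases lt_trichotomy h a with h1 | rfl | h1
  · rw [levList_triple_of_lt h1 hab, formHomotopy_keyForm3 𝔽 h1 hab, Int.cast_one, one_smul]
  · rw [levList_cons]
    simp [contract, wedge_self, wedge_swap 𝔽 b h]
  have e1 : levList [h, a, b] = -levList [a, h, b] := levList_append_swap [] [b] h a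
  rcases lt_trichotomy h b with h2 | rfl | h2
  · rw [Finset.insert_comm, formHomotopy_keyForm3 𝔽 h1 h2, e1, levList_triple_of_lt h1 h2]
    simp only [contract, wedge_swap 𝔽 h b, wedge_swap 𝔽 b a, wedge_swap 𝔽 a h,
      LinearMap.neg_apply]
    push_cast
    module
  · rw [levList_cons]
    simp [contract, wedge_self, wedge_swap 𝔽 h a]
  · have e2 : levList [a, h, b] = -levList [a, b, h] := levList_append_swap [a] [] h b
    have e3 : ({h, a, b} : Finset (Fin 5)) = {a, b, h} := by
      ext; simp; tauto
    rw [e3, formHomotopy_keyForm3 𝔽 hab h2, e1, e2, levList_triple_of_lt hab h2]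
    simp only [contract]
    push_cast
    module

lemma homotopy_vecField (i : Fin 5) (f : MvPolynomial (Fin 5) 𝔽) :
    phi 𝔽 (psi 𝔽 (vecField 𝔽 i f)) + divHomotopy 𝔽 (divMap 𝔽 (vecField 𝔽 i f)) +
      formHomotopy 𝔽 (dMap 𝔽 (vecField 𝔽 i f)) = vecField 𝔽 i f := by
  rw [psi_vecField, psiVec_apply, map_sum, divMap_vecField, divHomotopy_polyFun, dMap_vecField,
    ← pderiv_eulerInv]
  conv_rhs => rw [← euler_eulerInv 𝔽 four_ne_zero f]
  generalize eulerInv 𝔽 4 f = g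
  simp only [phi_aPoly, phiA, pderiv_mul, pderiv_X, Pi.single_apply, map_add, map_sum, map_smul,
    Finset.sum_add_distrib, Finset.sum_sub_distrib, ite_mul, one_mul, zero_mul, if_true,
    apply_ite (vecField 𝔽 _), map_zero, Finset.sum_ite_eq', Finset.mem_univ,
    Finset.sum_const, Finset.card_univ, Fintype.card_fin]
  push_cast
  module

lemma homotopy_wedge {a b : Fin 5} (h : a < b) (f : MvPolynomial (Fin 5) 𝔽) :
    phi 𝔽 (psi 𝔽 (wedge 𝔽 a b f)) + divHomotopy 𝔽 (divMap 𝔽 (wedge 𝔽 a b f)) +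
      formHomotopy 𝔽 (dMap 𝔽 (wedge 𝔽 a b f)) = wedge 𝔽 a b f := by
  rw [psi_wedge, psiForm_apply, map_sub, phi_bPoly, phi_bPoly, divMap_wedge, dMap_wedge, map_sum]
  simp only [map_smul, smul_formHomotopy_keyForm3 𝔽 _ h, ← pderiv_eulerInv]
  conv_rhs => rw [← euler_eulerInv 𝔽 two_ne_zero f]
  generalize eulerInv 𝔽 2 f = g
  simp only [phiB, contract, pderiv_mul, pderiv_X, Pi.single_apply, map_add, map_sum, map_smul,
    Finset.sum_add_distrib, ite_mul, one_mul, zero_mul, apply_ite (wedge 𝔽 _ _), map_zero,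
    Finset.sum_ite_eq, Finset.mem_univ, if_true, wedge_swap 𝔽 b a,
    wedge_swap 𝔽 _ a, LinearMap.neg_apply, Finset.sum_neg_distrib]
  push_cast
  module

lemma homotopy {v : EAmb 𝔽} (hv : v ∈ Finsupp.supported 𝔽 𝔽 validKeys) :
    phi 𝔽 (psi 𝔽 v) + divHomotopy 𝔽 (divMap 𝔽 v) + formHomotopy 𝔽 (dMap 𝔽 v) = v := by
  rw [Finsupp.supported_eq_span_single] at hv
  refine LinearMap.eqOn_span (f := phi 𝔽 ∘ₗ psi 𝔽 + divHomotopy 𝔽 ∘ₗ divMap 𝔽 +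
    formHomotopy 𝔽 ∘ₗ dMap 𝔽) (g := LinearMap.id) ?_ hv
  rintro _ ⟨⟨i, N⟩ | ⟨S, N⟩, hk, rfl⟩
  · simpa [vecField, polyLift_monomial] using homotopy_vecField 𝔽 i (monomial N 1)
  · have key : ∃ a b : Fin 5, a < b ∧ S = {a, b} := by
      obtain ⟨a, b, hab, rfl⟩ := Finset.card_eq_two.1 hk
      rcases lt_or_gt_of_ne hab with h | h
      · exact ⟨a, b, h, rfl⟩
      · exact ⟨b, a, h, Finset.pair_comm _ _⟩
    obtain ⟨a, b, h, rfl⟩ := key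
    have := homotopy_wedge 𝔽 h (monomial N 1)
    rw [wedge_of_lt 𝔽 h, keyForm, polyLift_monomial, one_smul] at this
    exact this

lemma phi_psi {v : EAmb 𝔽} (hv : v ∈ E510 𝔽) : phi 𝔽 (psi 𝔽 v) = v := by
  obtain ⟨⟨h1, h2⟩, h3⟩ := hv
  have h := homotopy 𝔽 h3
  rwa [LinearMap.mem_ker.1 h1, LinearMap.mem_ker.1 h2, map_zero, map_zero, add_zero,
    add_zero] at h

/-- The isomorphism `Φ : g(RE(5,10)) ≃ E(5,10)`. -/
noncomputable def annREEquiv : AnnRE 𝔽 ≃ₗ[𝔽] E510 𝔽 :=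
  LinearEquiv.ofLinearMap ((phi 𝔽).codRestrict (E510 𝔽) (phi_mem_E510 𝔽))
    (psi 𝔽 ∘ₗ (E510 𝔽).subtype)
    (LinearMap.ext fun v => Subtype.ext (phi_psi 𝔽 v.2)) (LinearMap.ext (psi_phi 𝔽))

lemma coe_annREEquiv (x : AnnRE 𝔽) : (annREEquiv 𝔽 x : EAmb 𝔽) = phi 𝔽 x := rfl

/-- **Theorem 6.12.**  Suppose `bA` is the Lie superalgebra bracket of `g(RE(5,10))`
(a bilinear map taking the values dictated by the `λ`-bracket of `RE(5,10)` on the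
spanning symbols).  Then the map `Φ` given on the spanning symbols by
`a_{ij} y^M ↦ -m_i x^{M-e_i} ∂_{x_j} + m_j x^{M-e_j} ∂_{x_i}` and
`b_k y^M ↦ Σ_{r≠k} m_r x^{M-e_r} dx_k∧dx_r` is a well-defined isomorphism of ℤ-graded
Lie superalgebras from `g(RE(5,10))` onto `E(5,10)` (with its principal gradation). -/
theorem annRE_iso_E510
    (bA : AnnRE 𝔽 →ₗ[𝔽] AnnRE 𝔽 →ₗ[𝔽] AnnRE 𝔽)
    (haa : ∀ i j M rr ss N, bA (aSym 𝔽 i j M) (aSym 𝔽 rr ss N) = gaa 𝔽 i j M rr ss N)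
    (hab : ∀ i j M k N, bA (aSym 𝔽 i j M) (bSym 𝔽 k N) = gab 𝔽 i j M k N)
    (hba : ∀ i j M k N, bA (bSym 𝔽 k N) (aSym 𝔽 i j M) = -gab 𝔽 i j M k N)
    (hbb : ∀ i M j N, bA (bSym 𝔽 i M) (bSym 𝔽 j N) = gbb 𝔽 i M j N) :
    ∃ Φ : AnnRE 𝔽 ≃ₗ[𝔽] E510 𝔽,
      (∀ i j M, (Φ (aSym 𝔽 i j M) : EAmb 𝔽) =
        -((M i : 𝔽) • Finsupp.single (Sum.inl (j, M - Finsupp.single i 1)) 1) +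
          (M j : 𝔽) • Finsupp.single (Sum.inl (i, M - Finsupp.single j 1)) 1) ∧
      (∀ k M, (Φ (bSym 𝔽 k M) : EAmb 𝔽) =
        ∑ t : Fin 5, (M t : 𝔽) • form2 𝔽 [k, t] (M - Finsupp.single t 1)) ∧
      (∀ x y : AnnRE 𝔽, (Φ (bA x y) : EAmb 𝔽) = Ebr 𝔽 (Φ x) (Φ y)) := by
  refine ⟨annREEquiv 𝔽, fun i j M => ?_, fun k M => ?_, fun x y => ?_⟩
  · simp only [coe_annREEquiv, phi_aSym, phiA, pderiv_monomial_one, map_smul, vecField,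
      polyLift_monomial, one_smul]
    abel
  · simp only [coe_annREEquiv, phi_bSym, phiB, pderiv_monomial_one, map_smul, form2_pair]
  · exact phi_bracket 𝔽 bA haa hab hba hbb x y
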